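/- arXiv:math/0501239 — 6 statements merged into one kernel-verified Lean document; each statement's English description precedes it below -/
import Mathlib

section
/- Let V be a finite-dimensional real vector space and h a nondegenerate symmetric bilinear form on V. Let R : V×V×V×V → ℝ be an algebraic curvature tensor on (V,h): R is antisymmetric in its first two arguments and in its last two arguments, symmetric under interchange of the first pair of arguments with the second pair, and satisfies the first Bianchi identity R(U,V,W,T) + R(V,W,U,T) + R(W,U,V,T) = 0. Suppose X ∈ V satisfies: for all U,V ∈ V the vector R(U,V)X lies in ℝ·X, where R(U,V) is the unique endomorphism with h(R(U,V)W,T) = R(U,V,W,T). Then R(X,Y,U,V) = 0 for every Y ∈ X⊥ := {Y ∈ V : h(X,Y) = 0} and all U,V ∈ V. -/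
/-- Section 5: if the curvature endomorphisms satisfy `R(U,V)X ∈ ℝ·X`, then `R(X,Y,·,·) = 0`
for every `Y` orthogonal to `X`. -/
theorem stmt_2 {V : Type*} [AddCommGroup V] [Module ℝ V] [FiniteDimensional ℝ V]
    (h : V →ₗ[ℝ] V →ₗ[ℝ] ℝ)
    (h_symm : ∀ x y : V, h x y = h y x)
    (h_nd : ∀ x : V, (∀ y : V, h x y = 0) → x = 0)
    (R : V →ₗ[ℝ] V →ₗ[ℝ] V →ₗ[ℝ] V →ₗ[ℝ] ℝ)
    (hR_anti12 : ∀ U V' W T : V, R U V' W T = - R V' U W T)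
    (hR_anti34 : ∀ U V' W T : V, R U V' W T = - R U V' T W)
    (hR_pair : ∀ U V' W T : V, R U V' W T = R W T U V')
    (hR_bianchi : ∀ U V' W T : V, R U V' W T + R V' W U T + R W U V' T = 0)
    (Rend : V →ₗ[ℝ] V →ₗ[ℝ] V →ₗ[ℝ] V)
    (hRend : ∀ U V' W T : V, h (Rend U V' W) T = R U V' W T)
    (X : V)
    (hX_rec : ∀ U V' : V, ∃ c : ℝ, Rend U V' X = c • X) :
    ∀ Y : V, h X Y = 0 → ∀ U V' : V, R X Y U V' = 0 := by
  intro Y hY U V'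
  obtain ⟨c, hc⟩ := hX_rec U V'
  rw [hR_pair, ← hRend, hc, map_smul, LinearMap.smul_apply, hY, smul_zero]
end

section
/- Let V be a finite-dimensional real vector space and h a nondegenerate symmetric bilinear form on V. Let R : V×V×V×V → ℝ be an algebraic curvature tensor on (V,h): R is antisymmetric in its first two arguments and in its last two arguments, symmetric under interchange of the first pair of arguments with the second pair, and satisfies the first Bianchi identity. For U,V ∈ V let R(U,V) denote the unique endomorphism with h(R(U,V)W,T) = R(U,V,W,T), and define the Ricci tensor of R by Ric(U,V) := trace of the linear map W ↦ R(W,U)V. Suppose X ∈ V is lightlike, i.e. X ≠ 0 and h(X,X) = 0, and suppose R(U,V)X ∈ ℝ·X for all U,V ∈ V. Then Ric(X,Y) = 0 for every Y ∈ X⊥ := {Y ∈ V : h(X,Y) = 0}. -/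
/-- Equation (null1) of Section 5: for a lightlike vector `X` with `R(U,V)X ∈ ℝ·X`,
the Ricci tensor satisfies `Ric(X,Y) = 0` for all `Y ∈ X⊥`. -/
theorem stmt_3 {V : Type*} [AddCommGroup V] [Module ℝ V] [FiniteDimensional ℝ V]
    (h : V →ₗ[ℝ] V →ₗ[ℝ] ℝ)
    (h_symm : ∀ x y : V, h x y = h y x)
    (h_nd : ∀ x : V, (∀ y : V, h x y = 0) → x = 0)
    (R : V →ₗ[ℝ] V →ₗ[ℝ] V →ₗ[ℝ] V →ₗ[ℝ] ℝ)
    (hR_anti12 : ∀ U V' W T : V, R U V' W T = - R V' U W T)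
    (hR_anti34 : ∀ U V' W T : V, R U V' W T = - R U V' T W)
    (hR_pair : ∀ U V' W T : V, R U V' W T = R W T U V')
    (hR_bianchi : ∀ U V' W T : V, R U V' W T + R V' W U T + R W U V' T = 0)
    (Rend : V →ₗ[ℝ] V →ₗ[ℝ] V →ₗ[ℝ] V)
    (hRend : ∀ U V' W T : V, h (Rend U V' W) T = R U V' W T)
    -- the Ricci tensor: `Ric(U,V) = trace (W ↦ R(W,U)V)`
    (Ric : V → V → ℝ)
    (hRic : ∀ U V' : V, Ric U V' = LinearMap.trace ℝ V ((Rend.flip U).flip V'))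
    (X : V) (hX_ne : X ≠ 0) (hX_null : h X X = 0)
    (hX_rec : ∀ U V' : V, ∃ c : ℝ, Rend U V' X = c • X) :
    ∀ Y : V, h X Y = 0 → Ric X Y = 0 := by
  intro Y hY
  obtain ⟨T₀, hT₀⟩ : ∃ T, h X T = 1 := by
    obtain ⟨T, hT⟩ : ∃ T, h X T ≠ 0 := by
      by_contra! H
      exact hX_ne (h_nd X H)
    exact ⟨(h X T)⁻¹ • T, by simp [hT]⟩
  have h_rank_one : (Rend.flip X).flip Y = (h X).smulRight (Rend T₀ X Y) := by
    ext W
    rw [← sub_eq_zero]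
    refine h_nd _ fun T => ?_
    obtain ⟨c, hc⟩ := hX_rec Y T
    have key (W : V) : R W X Y T = -(c * h X W) := by
      rw [hR_pair, hR_anti34, ← hRend, hc, map_smul, LinearMap.smul_apply, smul_eq_mul]
    simp only [LinearMap.flip_apply, LinearMap.smulRight_apply, map_sub, map_smul,
      LinearMap.sub_apply, LinearMap.smul_apply, smul_eq_mul, hRend, key, hT₀]
    ring
  obtain ⟨c, hc⟩ := hX_rec X T₀
  rw [hRic, h_rank_one, LinearMap.trace_smulRight, h_symm, hRend, hR_anti12, hR_anti34, neg_neg,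
    ← hRend, hc, map_smul, LinearMap.smul_apply, hY, smul_zero]
end

section
/- Let V be a finite-dimensional real vector space and h a nondegenerate symmetric bilinear form on V. Let R : V×V×V×V → ℝ be an algebraic curvature tensor on (V,h) (antisymmetric in its first two and in its last two arguments, symmetric under interchange of the two pairs, satisfying the first Bianchi identity), and for U,V ∈ V let R(U,V) denote the unique endomorphism with h(R(U,V)W,T) = R(U,V,W,T). Let X ∈ V be lightlike (X ≠ 0, h(X,X) = 0) and set X⊥ := {Y ∈ V : h(X,Y) = 0}. Then the following are equivalent: (i) R(U,V)Y ∈ ℝ·X for all U,V ∈ V and all Y ∈ X⊥; (ii) R(Y₁,Y₂) = 0 (as an endomorphism of V) for all Y₁,Y₂ ∈ X⊥. -/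
/-- For a left-separating bilinear form, a vector orthogonal to the kernel of `h X` is a multiple
of `X`. -/
theorem exists_eq_smul_of_orthogonal_ker {K V : Type*} [Field K] [AddCommGroup V] [Module K V]
    (h : V →ₗ[K] V →ₗ[K] K) (h_nd : ∀ x : V, (∀ y : V, h x y = 0) → x = 0)
    {X A : V} (hX : X ≠ 0) (hA : ∀ T : V, h X T = 0 → h A T = 0) :
    ∃ c : K, A = c • X := by
  obtain ⟨Z, hZ⟩ : ∃ Z, h X Z ≠ 0 := by
    by_contra! hc
    exact hX (h_nd X hc)
  refine ⟨h A Z / h X Z, sub_eq_zero.mp (h_nd _ fun y => ?_)⟩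
  have hy := hA (y - (h X y / h X Z) • Z) (by simp [hZ])
  simp only [map_sub, map_smul, LinearMap.sub_apply, LinearMap.smul_apply, smul_eq_mul] at hy ⊢
  rw [← hy]
  ring

/-- Equivalence of conditions (22) and (23) of the paper: curvature endomorphisms map `X⊥` into
`ℝ·X` iff `R(Y₁,Y₂) = 0` for all `Y₁, Y₂ ∈ X⊥`. -/
theorem stmt_5 {V : Type*} [AddCommGroup V] [Module ℝ V] [FiniteDimensional ℝ V]
    (h : V →ₗ[ℝ] V →ₗ[ℝ] ℝ)
    (h_symm : ∀ x y : V, h x y = h y x)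
    (h_nd : ∀ x : V, (∀ y : V, h x y = 0) → x = 0)
    (R : V →ₗ[ℝ] V →ₗ[ℝ] V →ₗ[ℝ] V →ₗ[ℝ] ℝ)
    (hR_anti12 : ∀ U V' W T : V, R U V' W T = - R V' U W T)
    (hR_anti34 : ∀ U V' W T : V, R U V' W T = - R U V' T W)
    (hR_pair : ∀ U V' W T : V, R U V' W T = R W T U V')
    (hR_bianchi : ∀ U V' W T : V, R U V' W T + R V' W U T + R W U V' T = 0)
    (Rend : V →ₗ[ℝ] V →ₗ[ℝ] V →ₗ[ℝ] V)
    (hRend : ∀ U V' W T : V, h (Rend U V' W) T = R U V' W T)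
    (X : V) (hX_ne : X ≠ 0) (hX_null : h X X = 0) :
    (∀ U V' Y : V, h X Y = 0 → ∃ c : ℝ, Rend U V' Y = c • X) ↔
      (∀ Y₁ Y₂ : V, h X Y₁ = 0 → h X Y₂ = 0 → Rend Y₁ Y₂ = 0) := by
  constructor
  · intro hi Y₁ Y₂ h₁ h₂
    refine LinearMap.ext fun W => h_nd _ fun T => ?_
    obtain ⟨c, hc⟩ := hi W T Y₁ h₁
    rw [hRend, hR_pair, ← hRend, hc]
    simp [h₂]
  · intro hii U V' Y hY
    refine exists_eq_smul_of_orthogonal_ker h h_nd hX_ne fun T hT => ?_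
    rw [hRend, hR_pair, ← hRend, hii Y T hY hT]
    simp
end

section
/- Let V be a finite-dimensional real vector space and h a nondegenerate symmetric bilinear form on V. Let R : V×V×V×V → ℝ be an algebraic curvature tensor on (V,h) (antisymmetric in its first two and in its last two arguments, symmetric under interchange of the two pairs, satisfying the first Bianchi identity), with curvature endomorphisms R(U,V) defined by h(R(U,V)W,T) = R(U,V,W,T). Let X ∈ V be lightlike (X ≠ 0, h(X,X) = 0), set X⊥ := {Y ∈ V : h(X,Y) = 0} and ξ := h(X, ·), and assume R(U,V)X ∈ ℝ·X for all U,V ∈ V. Then ξ(U)·R(V,W) + ξ(V)·R(W,U) + ξ(W)·R(U,V) = 0 (as endomorphisms of V) for all U,V,W ∈ V if and only if R(Y₁,Y₂) = 0 for all Y₁,Y₂ ∈ X⊥. -/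
/-- Pointwise content of Lemma 6.7: with a recurrent lightlike vector `X` (so `R(U,V)X ∈ ℝ·X`),
the skew-symmetrisation `Λ_{(1,2,3)}(ξ ⊗ R)` vanishes (with `ξ = h(X,·)`) iff
`R(Y₁,Y₂) = 0` for all `Y₁, Y₂ ∈ X⊥`. -/
theorem stmt_7 {V : Type*} [AddCommGroup V] [Module ℝ V] [FiniteDimensional ℝ V]
    (h : V →ₗ[ℝ] V →ₗ[ℝ] ℝ)
    (h_symm : ∀ x y : V, h x y = h y x)
    (h_nd : ∀ x : V, (∀ y : V, h x y = 0) → x = 0)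
    (R : V →ₗ[ℝ] V →ₗ[ℝ] V →ₗ[ℝ] V →ₗ[ℝ] ℝ)
    (hR_anti12 : ∀ U V' W T : V, R U V' W T = - R V' U W T)
    (hR_anti34 : ∀ U V' W T : V, R U V' W T = - R U V' T W)
    (hR_pair : ∀ U V' W T : V, R U V' W T = R W T U V')
    (hR_bianchi : ∀ U V' W T : V, R U V' W T + R V' W U T + R W U V' T = 0)
    (Rend : V →ₗ[ℝ] V →ₗ[ℝ] V →ₗ[ℝ] V)
    (hRend : ∀ U V' W T : V, h (Rend U V' W) T = R U V' W T)
    (X : V) (hX_ne : X ≠ 0) (hX_null : h X X = 0)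
    (hX_rec : ∀ U V' : V, ∃ c : ℝ, Rend U V' X = c • X) :
    (∀ U V' W : V,
        h X U • Rend V' W + h X V' • Rend W U + h X W • Rend U V' = 0) ↔
      (∀ Y₁ Y₂ : V, h X Y₁ = 0 → h X Y₂ = 0 → Rend Y₁ Y₂ = 0) := by
  have anti : ∀ A B : V, Rend A B = -Rend B A := by
    intro A B
    ext W
    rw [← sub_eq_zero]
    refine h_nd _ fun T => ?_
    simp only [map_sub, map_neg, LinearMap.sub_apply, LinearMap.neg_apply, hRend]
    linarith [hR_anti12 A B W T]
  obtain ⟨Z₀, hZ₀⟩ : ∃ Z, h X Z ≠ 0 := by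
    by_contra! hX
    exact hX_ne (h_nd X hX)
  constructor
  · intro H Y₁ Y₂ h₁ h₂
    simpa [h₁, h₂, hZ₀] using H Z₀ Y₁ Y₂
  · intro H U V' W
    obtain ⟨Z, hZ⟩ : ∃ Z, h X Z = 1 := ⟨(h X Z₀)⁻¹ • Z₀, by simp [hZ₀]⟩
    have expand : ∀ A B : V, Rend A B = h X B • Rend A Z - h X A • Rend B Z := by
      intro A B
      have hAB := H (A - h X A • Z) (B - h X B • Z) (by simp [hZ]) (by simp [hZ])
      have hZZ : Rend Z Z = 0 := by
        ext W
        rw [← sub_eq_zero]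
        refine h_nd _ fun T => ?_
        simp only [map_sub, LinearMap.sub_apply, LinearMap.zero_apply, map_zero, hRend]
        linarith [hR_anti12 Z Z W T]
      simp only [map_sub, map_smul, LinearMap.sub_apply, LinearMap.smul_apply, hZZ,
        anti Z B] at hAB
      rw [← sub_eq_zero, ← hAB]
      module
    rw [expand V' W, expand W U, expand U V']
    module
end

section
/- Let n ≥ 1 and equip V = ℝ^{n+4}, with standard basis labelled e_{x₁}, e_{x₂}, e_{y₁}, …, e_{y_n}, e_{z₁}, e_{z₂}, with the symmetric bilinear form ⟨.,.⟩ determined by ⟨e_{x₁}, e_{z₂}⟩ = ⟨e_{x₂}, e_{z₁}⟩ = 1, ⟨e_{y_i}, e_{y_j}⟩ = δ_{ij}, and all other pairings of basis vectors equal to 0 (a nondegenerate form of signature (2, n+2)). Let L := span(e_{x₁}, e_{x₂}) (a totally isotropic 2-dimensional subspace) and let 𝔤 := {A ∈ End(V) : ⟨Av, w⟩ + ⟨v, Aw⟩ = 0 for all v,w ∈ V, and A(L) ⊆ L}. Then there is no nonzero decomposable (n+2)-form α on V — i.e. no alternating (n+2)-form of the shape α = f₁ ∧ ⋯ ∧ f_{n+2}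 for linear functionals f₁,…,f_{n+2} on V — such that both (a) α(v, w₁,…,w_{n+1}) = 0 for all v ∈ L and all w₁,…,w_{n+1} ∈ V, and (b) Σᵢ α(v₁,…,A vᵢ,…,v_{n+2}) = 0 for all A ∈ 𝔤 and all v₁,…,v_{n+2} ∈ V. -/
/-- An alternating map that vanishes whenever its first argument is `x` vanishes whenever any of
its arguments is `x`. -/
theorem AlternatingMap.eq_zero_of_apply_cons_eq_zero {R M N : Type*} [Ring R] [AddCommGroup M]
    [Module R M] [AddCommGroup N] [Module R N] {n : ℕ} (α : AlternatingMap R M N (Fin (n + 1)))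
    {x : M} (hx : ∀ w : Fin n → M, α (Fin.cons x w) = 0) {v : Fin (n + 1) → M} {i : Fin (n + 1)}
    (hi : v i = x) : α v = 0 := by
  have hcons : v ∘ Equiv.swap 0 i = Fin.cons x (Fin.tail (v ∘ Equiv.swap 0 i)) := by
    conv_lhs => rw [← Fin.cons_self_tail (v ∘ Equiv.swap 0 i)]
    simp [hi]
  have h := α.map_perm v (Equiv.swap 0 i)
  rw [hcons, hx] at h
  exact (smul_eq_zero_iff_eq _).1 h.symm

/-- The infinitesimal action of a diagonal endomorphism on an alternating map, evaluated on
eigenvectors. -/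
theorem AlternatingMap.sum_update_of_eigenvectors {R M N ι : Type*} [CommRing R] [AddCommGroup M]
    [Module R M] [AddCommGroup N] [Module R N] [Fintype ι] [DecidableEq ι]
    (α : AlternatingMap R M N ι) (A : M →ₗ[R] M) (v : ι → M) (d : ι → R)
    (hA : ∀ i, A (v i) = d i • v i) :
    ∑ i, α (Function.update v i (A (v i))) = (∑ i, d i) • α v := by
  simp [hA, α.map_update_smul, Finset.sum_smul]

/-- An injection `Fin (n + 2) → Fin (n + 4)` that misses `0` and `1` hits the last element. -/
theorem Fin.exists_eq_last_of_injective {n : ℕ} {v : Fin (n + 2) → Fin (n + 4)}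
    (hv : Function.Injective v) (h0 : ∀ i, v i ≠ 0) (h1 : ∀ i, v i ≠ 1) :
    ∃ i, v i = Fin.last (n + 3) := by
  by_contra! hlast
  have hsub : Finset.univ.image v ⊆ ({0, 1, Fin.last (n + 3)} : Finset (Fin (n + 4)))ᶜ := by
    intro j hj
    obtain ⟨i, -, rfl⟩ := Finset.mem_image.1 hj
    simp [h0, h1, hlast]
  have hcard : ({0, 1, Fin.last (n + 3)} : Finset (Fin (n + 4))).card = 3 := by
    rw [Finset.card_eq_three]
    exact ⟨0, 1, Fin.last (n + 3), by simp, by simp [Fin.ext_iff],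
      by simp [Fin.ext_iff], rfl⟩
  have h := Finset.card_le_card hsub
  rw [Finset.card_image_of_injective _ hv, Finset.card_compl, hcard] at h
  simp at h

/-- The algebraic counterexample of the introduction: for the isotropy algebra `𝔤` of the
totally isotropic plane `L = span(e_{x₁}, e_{x₂})` in `ℝ^{n+4}` with a form of signature
`(2, n+2)`, there is no nonzero decomposable `(n+2)`-form `α` with `v ⌟ α = 0` for `v ∈ L`
that is annihilated by every `A ∈ 𝔤`. -/
theorem stmt_12 (n : ℕ) (hn : 1 ≤ n)
    (B : (Fin (n + 4) → ℝ) → (Fin (n + 4) → ℝ) → ℝ)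
    (hB : ∀ u v : Fin (n + 4) → ℝ,
      B u v = u 0 * v ⟨n + 3, by omega⟩ + u ⟨n + 3, by omega⟩ * v 0
        + u 1 * v ⟨n + 2, by omega⟩ + u ⟨n + 2, by omega⟩ * v 1
        + ∑ i : Fin (n + 4), if 2 ≤ (i : ℕ) ∧ (i : ℕ) < n + 2 then u i * v i else 0)
    (L : Submodule ℝ (Fin (n + 4) → ℝ))
    (hL : L = Submodule.span ℝ
      {Pi.single (0 : Fin (n + 4)) (1 : ℝ), Pi.single (1 : Fin (n + 4)) (1 : ℝ)}) :
    ¬ ∃ α : AlternatingMap ℝ (Fin (n + 4) → ℝ) ℝ (Fin (n + 2)),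
        α ≠ 0 ∧
        -- `α` is decomposable: `α = f₁ ∧ ⋯ ∧ f_{n+2}`
        (∃ f : Fin (n + 2) → ((Fin (n + 4) → ℝ) →ₗ[ℝ] ℝ),
          ∀ v : Fin (n + 2) → (Fin (n + 4) → ℝ),
            α v = Matrix.det (Matrix.of fun i j => f i (v j))) ∧
        -- (a) `v ⌟ α = 0` for all `v ∈ L`
        (∀ x ∈ L, ∀ w : Fin (n + 1) → (Fin (n + 4) → ℝ), α (Fin.cons x w) = 0) ∧
        -- (b) `A · α = 0` for all `A` in the isotropy algebra `𝔤` of `L` inside `𝔰𝔬(2,n+2)`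
        (∀ A : (Fin (n + 4) → ℝ) →ₗ[ℝ] (Fin (n + 4) → ℝ),
          (∀ v w : Fin (n + 4) → ℝ, B (A v) w + B v (A w) = 0) →
          (∀ v ∈ L, A v ∈ L) →
          ∀ v : Fin (n + 2) → (Fin (n + 4) → ℝ),
            ∑ i, α (Function.update v i (A (v i))) = 0) := by
  rintro ⟨α, hα, -, hcontr, hinv⟩
  apply hα
  have hL0 : Pi.single (0 : Fin (n + 4)) (1 : ℝ) ∈ L :=
    hL ▸ Submodule.subset_span (by simp)
  have hL1 : Pi.single (1 : Fin (n + 4)) (1 : ℝ) ∈ L :=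
    hL ▸ Submodule.subset_span (by simp)
  refine (Pi.basisFun ℝ (Fin (n + 4))).ext_alternating fun v hv => ?_
  simp only [Pi.basisFun_apply, AlternatingMap.zero_apply]
  by_cases h0 : ∃ i, v i = 0
  · obtain ⟨i, hi⟩ := h0
    exact α.eq_zero_of_apply_cons_eq_zero (hcontr _ hL0) (i := i) (by rw [hi])
  by_cases h1 : ∃ i, v i = 1
  · obtain ⟨i, hi⟩ := h1
    exact α.eq_zero_of_apply_cons_eq_zero (hcontr _ hL1) (i := i) (by rw [hi])
  push Not at h0 h1
  obtain ⟨k, hk⟩ := Fin.exists_eq_last_of_injective hv h0 h1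
  let d : Fin (n + 4) → ℝ := Pi.single 0 1 - Pi.single (Fin.last (n + 3)) 1
  let A : (Fin (n + 4) → ℝ) →ₗ[ℝ] (Fin (n + 4) → ℝ) := LinearMap.mulLeft ℝ d
  have hA (j : Fin (n + 4)) : A (Pi.single j 1) = d j • Pi.single j 1 := by
    ext l
    obtain rfl | hl := eq_or_ne l j <;> simp [A, *]
  have hskew (u w : Fin (n + 4) → ℝ) : B (A u) w + B u (A w) = 0 := by
    have hd0 : d 0 = 1 := by simp [d, Fin.ext_iff]
    have hdlast : d ⟨n + 3, by omega⟩ = -1 := by simp [d, Fin.ext_iff, Pi.single_apply]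
    have hd (j : Fin (n + 4)) (hj : 1 ≤ (j : ℕ)) (hj' : (j : ℕ) < n + 3) : d j = 0 := by
      have h : j ≠ 0 := by simp only [ne_eq, Fin.ext_iff, Fin.val_zero]; omega
      have h' : j ≠ Fin.last (n + 3) := by simp only [ne_eq, Fin.ext_iff, Fin.val_last]; omega
      simp [d, h, h']
    have hsum (c : Fin (n + 4) → ℝ) :
        (∑ i : Fin (n + 4), if 2 ≤ (i : ℕ) ∧ (i : ℕ) < n + 2 then d i * c i else 0) = 0 := by
      refine Finset.sum_eq_zero fun i _ => ?_
      split_ifs with h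
      · rw [hd i (by omega) (by omega), zero_mul]
      · rfl
    have hsum₁ := hsum fun i => u i * w i
    simp only [← mul_assoc] at hsum₁
    have hsum₂ := hsum fun i => u i * w i
    simp only [mul_left_comm (d _)] at hsum₂
    simp only [hB, A, LinearMap.mulLeft_apply, Pi.mul_apply, hsum₁, hsum₂, hd0, hdlast,
      hd 1 (by simp) (by simp), hd ⟨n + 2, by omega⟩ (by simp) (by simp)]
    ring
  have hAL : ∀ x ∈ L, A x ∈ L := by
    suffices h : L ≤ L.comap A from h
    conv_lhs => rw [hL]
    rw [Submodule.span_le]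
    rintro x (rfl | rfl)
    · simpa only [SetLike.mem_coe, Submodule.mem_comap, hA] using L.smul_mem _ hL0
    · simpa only [SetLike.mem_coe, Submodule.mem_comap, hA] using L.smul_mem _ hL1
  have hsum : ∑ i, d (v i) = -1 := by
    rw [Finset.sum_eq_single k]
    · simp [d, hk, Fin.ext_iff]
    · intro i _ hik
      have h : v i ≠ Fin.last (n + 3) := fun h => hik (hv (h.trans hk.symm))
      simp [d, h, h0 i]
    · simp
  have h := hinv A hskew hAL fun i => Pi.single (v i) 1
  rw [α.sum_update_of_eigenvectors A _ (fun i => d (v i)) fun i => hA (v i), hsum] at h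
  simpa using h
end

section
/- Let V be a finite-dimensional real vector space with a nondegenerate symmetric bilinear form ⟨.,.⟩, and let 𝔄 be a set of endomorphisms of V each of which is skew-adjoint with respect to ⟨.,.⟩ (⟨Av,w⟩ + ⟨v,Aw⟩ = 0 for all v,w). Let W ⊆ V be a subspace such that A(W) ⊆ W for all A ∈ 𝔄 and such that the restriction of ⟨.,.⟩ to W is nondegenerate. Set k := dim V − dim W. Then there exists a nonzero decomposable k-form α on V — an alternating k-form of the shape α = f₁ ∧ ⋯ ∧ f_k for linear functionals f₁,…,f_k — such that Σᵢ α(v₁,…,A vᵢ,…,v_k) = 0 for all A ∈ 𝔄 and all v₁,…,v_k ∈ V, and such that {v ∈ V : α(v, w₁,…,w_{k−1}) = 0 for all w₁,…,w_{k−1} ∈ V} = W. -/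
namespace Matrix

variable {n : Type*} [Fintype n] [DecidableEq n]

/-- The derivative at `1` of the determinant: replacing the columns of `M` by those of `C * M`,
one at a time, and adding up the determinants yields `trace C * det M`. -/
lemma sum_det_updateCol_mul_col {R : Type*} [CommRing R] (C M : Matrix n n R) :
    ∑ j, (M.updateCol j fun i => (C * M) i j).det = C.trace * M.det := by
  have h (j : n) : (M.updateCol j fun i => (C * M) i j).det = (M.adjugate * (C * M)) j j := by
    rw [← cramer_apply, cramer_eq_adjugate_mulVec]
    rfl
  calc ∑ j, (M.updateCol j fun i => (C * M) i j).det = (M.adjugate * (C * M)).trace :=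
        Finset.sum_congr rfl fun j _ => h j
    _ = C.trace * M.det := by
        rw [trace_mul_comm, mul_assoc, mul_adjugate, mul_smul_comm, mul_one, trace_smul,
          smul_eq_mul, mul_comm]

/-- A matrix that is skew-adjoint with respect to an invertible matrix has trace zero. -/
lemma trace_eq_zero_of_mul_add_mul_transpose_eq_zero {K : Type*} [Field K] [CharZero K]
    {C G : Matrix n n K} (hG : G.det ≠ 0) (h : C * G + G * Cᵀ = 0) : C.trace = 0 := by
  have hu : IsUnit G.det := isUnit_iff_ne_zero.mpr hG
  have h₁ : C = -(G * Cᵀ * G⁻¹) := by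
    rw [← neg_mul, ← eq_neg_of_add_eq_zero_left h, mul_assoc, mul_nonsing_inv _ hu, mul_one]
  have h₂ : C.trace = -C.trace := by
    conv_lhs => rw [h₁, trace_neg, trace_mul_comm, ← mul_assoc, nonsing_inv_mul _ hu, one_mul,
      trace_transpose]
  exact self_eq_neg.mp h₂

end Matrix


/-- The positive converse from the introduction: a nondegenerate subspace `W` invariant under a
set `𝔄` of skew-adjoint endomorphisms gives rise to a nonzero decomposable `k`-form
(`k = codim W`) annihilated by every `A ∈ 𝔄` and whose kernel `{v : v ⌟ α = 0}` is exactly `W`. -/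
theorem stmt_13 {V : Type*} [AddCommGroup V] [Module ℝ V] [FiniteDimensional ℝ V]
    (g : V →ₗ[ℝ] V →ₗ[ℝ] ℝ)
    (hg_symm : ∀ x y : V, g x y = g y x)
    (hg_nd : ∀ x : V, (∀ y : V, g x y = 0) → x = 0)
    (𝔄 : Set (V →ₗ[ℝ] V))
    (hskew : ∀ A ∈ 𝔄, ∀ v w : V, g (A v) w + g v (A w) = 0)
    (W : Submodule ℝ V)
    (hinv : ∀ A ∈ 𝔄, ∀ w ∈ W, A w ∈ W)
    (hWnd : ∀ w ∈ W, (∀ w' ∈ W, g w w' = 0) → w = 0)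
    (k : ℕ) (hk : k = Module.finrank ℝ V - Module.finrank ℝ W) :
    ∃ α : AlternatingMap ℝ V ℝ (Fin k),
      α ≠ 0 ∧
      -- `α` is decomposable: `α = f₁ ∧ ⋯ ∧ f_k`
      (∃ f : Fin k → (V →ₗ[ℝ] ℝ),
        ∀ v : Fin k → V, α v = Matrix.det (Matrix.of fun i j => f i (v j))) ∧
      -- `A · α = 0` for all `A ∈ 𝔄`
      (∀ A ∈ 𝔄, ∀ v : Fin k → V, ∑ i, α (Function.update v i (A (v i))) = 0) ∧
      -- `{v : v ⌟ α = 0} = W`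
      (∀ x : V, (∀ (v : Fin k → V) (i : Fin k), v i = x → α v = 0) ↔ x ∈ W) := by
  have hrefl : LinearMap.BilinForm.IsRefl g := fun x y h => by rw [hg_symm, h]
  have hnd : LinearMap.BilinForm.Nondegenerate g :=
    (LinearMap.IsRefl.nondegenerate_iff_separatingLeft hrefl).mpr hg_nd
  have hWnd' : (LinearMap.BilinForm.restrict g W).Nondegenerate :=
    .ofSeparatingLeft fun x hx => Subtype.ext (hWnd x x.2 fun y hy => hx ⟨y, hy⟩)
  set U : Submodule ℝ V := LinearMap.BilinForm.orthogonal g W with hU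
  have hUU : LinearMap.BilinForm.orthogonal g U = W :=
    LinearMap.BilinForm.orthogonal_orthogonal hnd hrefl W
  have hUnd : (LinearMap.BilinForm.restrict g U).Nondegenerate := by
    rw [LinearMap.BilinForm.restrict_nondegenerate_iff_isCompl_orthogonal hrefl, hUU]
    exact (LinearMap.BilinForm.isCompl_orthogonal_of_restrict_nondegenerate hrefl hWnd').symm
  have hkU : Module.finrank ℝ U = k := by
    rw [hk, hU, LinearMap.BilinForm.finrank_orthogonal hnd]
  let e : Module.Basis (Fin k) ℝ U := Module.finBasisOfFinrankEq ℝ U hkU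
  let f : V →ₗ[ℝ] Fin k → ℝ := LinearMap.pi fun i => g (e i)
  let M (v : Fin k → V) : Matrix (Fin k) (Fin k) ℝ := Matrix.of fun i j => g (e i) (v j)
  have hMupd (v : Fin k → V) (i : Fin k) (x : V) :
      M (Function.update v i x) = (M v).updateCol i (f x) := by
    ext a b
    by_cases hb : b = i
    · subst hb; simp [M, f]
    · simp [M, hb]
  let G := M fun i => e i
  have hG : G.det ≠ 0 := by
    have h := (LinearMap.BilinForm.nondegenerate_iff_det_ne_zero e).mp hUnd
    convert h using 2
    ext i j
    rw [LinearMap.BilinForm.toMatrix_apply]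
    rfl
  have hker (x : V) : f x = 0 ↔ x ∈ W := by
    rw [← hUU]
    refine ⟨fun h u hu => ?_, fun h => funext fun i => h _ (e i).2⟩
    have h₁ : (g.flip x).comp U.subtype = 0 := e.ext fun i => congrFun h i
    exact LinearMap.congr_fun h₁ ⟨u, hu⟩
  let α : AlternatingMap ℝ V ℝ (Fin k) := Matrix.detRowAlternating.compLinearMap f
  have hα (v : Fin k → V) : α v = (M v).det := Matrix.det_transpose (M v)
  refine ⟨α, fun h => hG ?_, ⟨fun i => g (e i), hα⟩, fun A hA v => ?_, fun x => ⟨fun h => ?_, ?_⟩⟩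
  · rw [← hα, h, AlternatingMap.zero_apply]
  · have hAU (u : V) (hu : u ∈ U) : A u ∈ U := fun w hw => by
      have h₁ := hskew A hA w u
      rwa [hu _ (hinv A hA w hw), zero_add] at h₁
    let C : Matrix (Fin k) (Fin k) ℝ := Matrix.of fun i l => e.repr ⟨A (e i), hAU _ (e i).2⟩ l
    have hC (i : Fin k) : A (e i) = ∑ l, C i l • (e l : V) := by
      have h₁ := congrArg Subtype.val (e.sum_repr ⟨A (e i), hAU _ (e i).2⟩)
      rw [AddSubmonoidClass.coe_finsetSum] at h₁
      exact h₁.symm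
    have hCM (w : Fin k → V) (i j : Fin k) : (C * M w) i j = g (A (e i)) (w j) := by
      simp [hC, Matrix.mul_apply, M]
    have htr : C.trace = 0 := by
      refine Matrix.trace_eq_zero_of_mul_add_mul_transpose_eq_zero hG ?_
      have hGt : G.transpose = G := by
        ext i j
        exact hg_symm _ _
      ext i j
      have h₁ : (G * C.transpose) i j = (C * G) j i := by
        rw [← Matrix.transpose_apply (C * G), Matrix.transpose_mul, hGt]
      rw [Matrix.add_apply, h₁, hCM, hCM, hg_symm (A (e j))]
      exact hskew A hA _ _
    have hcol (j : Fin k) : f (A (v j)) = fun i => (-C * M v) i j := by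
      ext i
      rw [Matrix.neg_mul, Matrix.neg_apply, hCM]
      exact eq_neg_of_add_eq_zero_right (hskew A hA _ _)
    simp_rw [hα, hMupd, hcol]
    rw [Matrix.sum_det_updateCol_mul_col, Matrix.trace_neg, htr, neg_zero, zero_mul]
  · have h₁ : G.cramer (f x) = 0 := funext fun i => by
      rw [Matrix.cramer_apply, ← hMupd, ← hα]
      exact h _ i (Function.update_self ..)
    have h₂ := Matrix.mulVec_cramer G (f x)
    rw [h₁, Matrix.mulVec_zero] at h₂
    exact (hker x).mp ((smul_eq_zero.mp h₂.symm).resolve_left hG)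
  · rintro hx v i rfl
    rw [hα]
    exact Matrix.det_eq_zero_of_column_eq_zero i (congrFun ((hker _).mpr hx))
end
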